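/- arXiv:1902.02250 — 3 statements merged into one kernel-verified Lean document; each statement's English description precedes it below -/
import Mathlib

section
/- Let n ≥ 1 and let s_k = cos(kπ/n) for k = 0, …, n be the Chebyshev points of the second kind. Then these points are distinct and their barycentric weights satisfy 1/∏_{j=0, j≠k}^{n}(s_k − s_j) = (−1)^k δ_k · 2^{n−1}/n, where δ_0 = δ_n = 1/2 and δ_k = 1 for 1 ≤ k ≤ n−1 (Salzer's formula). -/
open Finset Real

open Polynomial Polynomial.Chebyshev in
theorem derivative_X_sq_sub_one_mul_U (n : ℤ) :
    derivative ((X ^ 2 - 1) * U ℝ (n - 1)) = X * U ℝ (n - 1) + (n : ℝ[X]) * T ℝ n := by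
  have h := add_one_mul_T_eq_poly_in_U (R := ℝ) (n - 1)
  simp only [sub_add_cancel, Int.cast_sub, Int.cast_one] at h
  simp only [derivative_mul, derivative_sub, derivative_X_pow, derivative_one]
  rw [h]
  simp only [Nat.cast_ofNat, map_ofNat, Nat.add_one_sub_one, pow_one, sub_zero]
  ring

open Polynomial Polynomial.Chebyshev in
theorem C_two_pow_mul_nodal_eq (n : ℕ) (hn : 1 ≤ n) (s : Fin (n + 1) → ℝ)
    (hsdef : ∀ k, s k = Real.cos (k * π / n)) (hs : Function.Injective s) :
    C (2 ^ (n - 1)) * Lagrange.nodal univ s = (X ^ 2 - 1) * U ℝ ((n : ℤ) - 1) := by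
  have hn0 : (n : ℝ) ≠ 0 := by positivity
  obtain ⟨m, rfl⟩ : ∃ m, n = m + 1 := ⟨n - 1, by omega⟩
  have hcast : ((m + 1 : ℕ) : ℤ) - 1 = m := by push_cast; ring
  rw [hcast, Nat.add_sub_cancel]
  have hmonic : (X ^ 2 - 1 : ℝ[X]).Monic := by
    simpa using monic_X_pow_sub_C (1 : ℝ) two_ne_zero
  have hdegX : (X ^ 2 - 1 : ℝ[X]).degree = 2 := by
    simpa using degree_X_pow_sub_C (n := 2) (by norm_num) (1 : ℝ)
  have hdegN : (C ((2 : ℝ) ^ m) * Lagrange.nodal univ s).degree = (m + 2 : ℕ) := by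
    rw [degree_C_mul (by positivity), Lagrange.degree_nodal]
    simp [add_assoc, one_add_one_eq_two]
  refine Polynomial.eq_of_degree_le_of_eval_index_eq univ hs.injOn ?_ ?_ ?_ ?_
  · rw [hdegN]; simp [add_assoc, one_add_one_eq_two]
  · rw [hdegN, degree_mul, hdegX, degree_U_natCast]
    push_cast; ring
  · rw [leadingCoeff_mul, leadingCoeff_mul, hmonic.leadingCoeff, leadingCoeff_C,
      Lagrange.nodal_monic.leadingCoeff, leadingCoeff_U_natCast]
    ring
  · intro k _
    rw [eval_mul, Lagrange.eval_nodal_at_node (mem_univ k), mul_zero, hsdef]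
    set θ := (k : ℝ) * π / (m + 1 : ℕ) with hθ
    have hU := U_real_cos θ m
    have hsin : Real.sin (((m : ℤ) + 1) * θ) = 0 := by
      rw [← Real.sin_nat_mul_pi k, hθ]
      congr 1
      push_cast at hn0 ⊢
      field_simp
    rw [hsin] at hU
    simp only [eval_mul, eval_sub, eval_pow, eval_X, eval_one]
    linear_combination Real.sin θ * hU -
      eval (Real.cos θ) (U ℝ m) * Real.sin_sq_add_cos_sq θ

/-- **Salzer's formula for barycentric weights at Chebyshev points of the second kind.**
Let `n ≥ 1` and let `s k = cos (k π / n)` for `k = 0, …, n`.  Then these points are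
distinct and their barycentric weights satisfy
`1 / ∏_{j≠k} (s k - s j) = (-1)^k δ_k · 2^(n-1) / n`, where `δ_0 = δ_n = 1/2` and
`δ_k = 1` for `1 ≤ k ≤ n-1`. -/
theorem salzer_weights (n : ℕ) (hn : 1 ≤ n)
    (s : Fin (n + 1) → ℝ) (hsdef : ∀ k, s k = Real.cos (k * π / n)) :
    Function.Injective s ∧
      ∀ k : Fin (n + 1),
        (∏ j ∈ Finset.univ.erase k, (s k - s j))⁻¹ =
          (-1 : ℝ) ^ (k : ℕ) *
            (if (k : ℕ) = 0 ∨ (k : ℕ) = n then (1 / 2 : ℝ) else 1) * 2 ^ (n - 1) / n := by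
  have hn0 : (n : ℝ) ≠ 0 := by positivity
  have hs : Function.Injective s := by
    intro i j hij
    rw [hsdef, hsdef] at hij
    exact Fin.ext ((Polynomial.Chebyshev.strictAntiOn_node n).injOn
      (by simpa using Fin.is_le i) (by simpa using Fin.is_le j) hij)
  refine ⟨hs, fun k => ?_⟩
  have hprod : 2 ^ (n - 1) * ∏ j ∈ univ.erase k, (s k - s j) =
      s k * (Polynomial.Chebyshev.U ℝ ((n : ℤ) - 1)).eval (s k) + n * (-1) ^ (k : ℕ) := by
    have h := congrArg (fun p => p.derivative.eval (s k))
      (C_two_pow_mul_nodal_eq n hn s hsdef hs)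
    simp only [derivative_X_sq_sub_one_mul_U, Polynomial.derivative_C_mul, Polynomial.eval_C_mul,
      Lagrange.eval_nodal_derivative_eval_node_eq (mem_univ k), Lagrange.eval_nodal] at h
    have hT : (Polynomial.Chebyshev.T ℝ n).eval (s k) = (-1) ^ (k : ℕ) := by
      rw [hsdef]
      exact Polynomial.Chebyshev.eval_T_real_node (by simpa using Fin.is_le k)
    simpa [hT] using h
  suffices h : 2 ^ (n - 1) * (∏ j ∈ univ.erase k, (s k - s j)) *
      (if (k : ℕ) = 0 ∨ (k : ℕ) = n then (1 / 2 : ℝ) else 1) = n * (-1) ^ (k : ℕ) by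
    refine inv_eq_of_mul_eq_one_right ?_
    have hsq : ((-1 : ℝ) ^ (k : ℕ)) * (-1) ^ (k : ℕ) = 1 := by
      rw [← mul_pow]; simp
    field_simp
    linear_combination (-1 : ℝ) ^ (k : ℕ) * h + n * hsq
  rw [hprod]
  split_ifs with hk
  · obtain hk | hk := hk
    · have h1 : s k = 1 := by simp [hsdef, hk]
      rw [h1, Polynomial.Chebyshev.U_eval_one, hk]
      push_cast; ring
    · have h1 : s k = -1 := by rw [hsdef, hk, mul_div_cancel_left₀ _ hn0, Real.cos_pi]
      rw [h1, Polynomial.Chebyshev.U_eval_neg_one, hk, Int.negOnePow_sub]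
      simp
      ring
  · push Not at hk
    have hsin : 0 < Real.sin (k * π / n) := by
      have hk0 : (0 : ℝ) < (k : ℕ) := by exact_mod_cast Nat.pos_of_ne_zero hk.1
      have hkn : ((k : ℕ) : ℝ) < n := by
        exact_mod_cast lt_of_le_of_ne (Fin.is_le k) hk.2
      apply Real.sin_pos_of_pos_of_lt_pi
      · positivity
      · rw [div_lt_iff₀ (by positivity), mul_comm]
        exact mul_lt_mul_of_pos_left hkn Real.pi_pos
    have hU := Polynomial.Chebyshev.U_real_cos (k * π / n) ((n : ℤ) - 1)
    have hzero : Real.sin ((((n : ℤ) - 1 : ℤ) + 1) * (k * π / n)) = 0 := by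
      rw [← Real.sin_nat_mul_pi k]
      congr 1
      push_cast
      field_simp
      ring
    rw [hzero, ← hsdef] at hU
    rw [(mul_eq_zero.mp hU).resolve_right hsin.ne']
    ring
end

section
/- Let n ≥ 1, let s_k = cos(kπ/n) for k = 0, …, n be the Chebyshev points of the second kind, and let f_0, …, f_n be real values. Let p be the unique polynomial of degree at most n with p(s_k) = f_k for all k. Then for every real t with t ≠ s_j for all j, p(t) = (∑_{k=0}^{n} ((−1)^k δ_k/(t − s_k)) f_k) / (∑_{k=0}^{n} (−1)^k δ_k/(t − s_k)), where δ_0 = δ_n = 1/2 and δ_k = 1 for 1 ≤ k ≤ n−1; i.e., by scale-invariance of the barycentric form, the simplified weights (−1)^k δ_k may be used in place of the true barycentric weights at Chebyshev points of the second kind. -/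
open Finset Real Polynomial

namespace Polynomial.Chebyshev

/-- Each Chebyshev point of the second kind is `±1` or a critical point of `T n`. -/
lemma one_sub_sq_mul_eval_derivative_T_node {n k : ℕ} (hn : n ≠ 0) :
    (1 - node n k ^ 2) * (derivative (T ℝ n)).eval (node n k) = 0 := by
  have hU := U_real_cos (k * π / n) ((n : ℤ) - 1)
  have hn' : (n : ℝ) ≠ 0 := Nat.cast_ne_zero.mpr hn
  have harg : (((n : ℤ) - 1 : ℤ) + 1 : ℝ) * (k * π / n) = k * π := by
    push_cast
    field
  rw [harg, sin_nat_mul_pi] at hU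
  rw [node, ← sin_sq, T_derivative_eq_U, eval_mul]
  linear_combination (eval (cos (k * π / n)) (n : ℝ[X])) * sin (k * π / n) * hU

lemma node_sq_ne_one {n k : ℕ} (hk₀ : 0 < k) (hk : k < n) : node n k ^ 2 ≠ 1 := by
  have h1 : node n k < 1 := node_eq_one (n := n) ▸ node_lt hk.le hk₀
  have h2 : -1 < node n k := node_eq_neg_one (by omega : n ≠ 0) ▸ node_lt le_rfl hk
  nlinarith

/-- The value at a Chebyshev point of the derivative of `(1 - X ^ 2) * derivative (T n)`, the
polynomial whose roots are the Chebyshev points of the second kind. -/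
lemma eval_derivative_one_sub_X_sq_mul_derivative_T_node {n k : ℕ} (hn : n ≠ 0) (hk : k ≤ n) :
    (if k = 0 ∨ k = n then (1 / 2 : ℝ) else 1) *
      (derivative ((1 - X ^ 2) * derivative (T ℝ n))).eval (node n k) = -n ^ 2 * (-1) ^ k := by
  have hode := congr_arg (eval (node n k))
    (one_sub_X_sq_mul_derivative_derivative_T_eq_poly_in_T (R := ℝ) n)
  have hT := eval_T_real_node (Finset.mem_Iic.mpr hk)
  have hT' := one_sub_sq_mul_eval_derivative_T_node (k := k) hn
  simp only [Function.iterate_succ, Function.iterate_zero, Function.comp_apply, id, eval_mul,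
    eval_sub, eval_one, eval_pow, eval_X, Int.cast_natCast, eval_natCast, hT] at hode
  simp only [derivative_mul, derivative_sub, derivative_one, derivative_X_pow, eval_add, eval_mul,
    eval_sub, eval_one, eval_pow, eval_X, eval_zero, eval_C]
  push_cast
  split_ifs with h
  · have hx : node n k ^ 2 = 1 := by
      rcases h with rfl | rfl
      · simp [node_eq_one]
      · simp [node_eq_neg_one hn]
    rw [hx] at hode ⊢
    linear_combination hode
  · have h0 := (mul_eq_zero.mp hT').resolve_left
      (sub_ne_zero.mpr (node_sq_ne_one (by omega) (by omega)).symm)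
    rw [h0] at hode ⊢
    linear_combination hode

lemma injective_node_fin (n : ℕ) : Function.Injective fun i : Fin (n + 1) ↦ node n i :=
  fun i j h ↦ Fin.ext <| (strictAntiOn_node n).injOn (by simp; omega) (by simp; omega) h

/-- `(1 - X ^ 2) * derivative (T n)` is a multiple of the nodal polynomial of the
Chebyshev points. -/
lemma exists_one_sub_X_sq_mul_derivative_T_eq {n : ℕ} (hn : n ≠ 0) :
    ∃ c : ℝ, (1 - X ^ 2) * derivative (T ℝ n) =
      Polynomial.C c * Lagrange.nodal univ fun i : Fin (n + 1) ↦ node n i := by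
  refine ⟨_, eq_leadingCoeff_mul_of_monic_of_dvd_of_natDegree_le Lagrange.nodal_monic ?_ ?_⟩
  · refine Finset.prod_dvd_of_coprime
      ((pairwise_coprime_X_sub_C (injective_node_fin n)).set_pairwise _) fun i _ ↦ ?_
    rw [dvd_iff_isRoot]
    simpa [IsRoot] using one_sub_sq_mul_eval_derivative_T_node hn
  · rw [Lagrange.natDegree_nodal, card_univ, Fintype.card_fin]
    have h1 : (1 - X ^ 2 : ℝ[X]).natDegree ≤ 2 := by compute_degree
    have h2 := natDegree_derivative_le (T ℝ n)
    rw [natDegree_T, Int.natAbs_natCast] at h2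
    exact natDegree_mul_le.trans (by omega)

/-- The barycentric weights at the Chebyshev points of the second kind are, up to a common factor,
`1/2, -1, 1, …, ±1/2`. -/
lemma exists_mul_nodalWeight_node {n : ℕ} (hn : n ≠ 0) :
    ∃ c : ℝ, c ≠ 0 ∧ ∀ k : Fin (n + 1),
      (-1) ^ (k : ℕ) * (if (k : ℕ) = 0 ∨ (k : ℕ) = n then (1 / 2 : ℝ) else 1) =
        c * Lagrange.nodalWeight univ (fun i : Fin (n + 1) ↦ node n i) k := by
  obtain ⟨c, hc⟩ := exists_one_sub_X_sq_mul_derivative_T_eq hn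
  have hn' : (n : ℝ) ≠ 0 := Nat.cast_ne_zero.mpr hn
  have key (k : Fin (n + 1)) :=
    eval_derivative_one_sub_X_sq_mul_derivative_T_node hn (Nat.lt_succ_iff.mp k.isLt)
  simp only [hc, derivative_C_mul, eval_C_mul] at key
  have hc0 : c ≠ 0 := by
    rintro rfl
    simpa [hn'] using key 0
  refine ⟨-n ^ 2 / c, by simp [hn', hc0], fun k ↦ ?_⟩
  rw [Lagrange.nodalWeight_eq_eval_derivative_nodal (mem_univ k)]
  have hD : eval (node n k)
      (derivative (Lagrange.nodal univ fun i : Fin (n + 1) ↦ node n i)) ≠ 0 := by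
    intro h
    simpa [h, hn'] using key k
  have hsq : ((-1 : ℝ) ^ (k : ℕ)) * (-1) ^ (k : ℕ) = 1 := by
    rw [← mul_pow]
    simp
  field_simp
  linear_combination (-1) ^ (k : ℕ) * key k - n ^ 2 * hsq

end Polynomial.Chebyshev

/-- **Barycentric interpolation with simplified weights at Chebyshev points of the second
kind.**  Let `n ≥ 1`, let `s k = cos (k π / n)` for `k = 0, …, n`, and let `f 0, …, f n`
be real values.  If `p` is the (unique) polynomial of degree at most `n` with
`p (s k) = f k` for all `k`, then for every real `t` different from all the nodes,
`p t = (∑ k, ((-1)^k δ_k / (t - s k)) * f k) / (∑ k, (-1)^k δ_k / (t - s k))`, where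
`δ_0 = δ_n = 1/2` and `δ_k = 1` for `1 ≤ k ≤ n-1`. -/
theorem barycentric_chebyshev_simple_weights (n : ℕ) (hn : 1 ≤ n)
    (s : Fin (n + 1) → ℝ) (hsdef : ∀ k, s k = Real.cos (k * π / n))
    (f : Fin (n + 1) → ℝ) (p : Polynomial ℝ)
    (hdeg : p.degree ≤ n) (hinterp : ∀ k, p.eval (s k) = f k)
    (t : ℝ) (ht : ∀ j, t ≠ s j) :
    p.eval t =
      (∑ k : Fin (n + 1),
          ((-1 : ℝ) ^ (k : ℕ) *
              (if (k : ℕ) = 0 ∨ (k : ℕ) = n then (1 / 2 : ℝ) else 1) / (t - s k)) * f k) /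
        (∑ k : Fin (n + 1),
          (-1 : ℝ) ^ (k : ℕ) *
            (if (k : ℕ) = 0 ∨ (k : ℕ) = n then (1 / 2 : ℝ) else 1) / (t - s k)) := by
  have hs : s = fun k : Fin (n + 1) ↦ Chebyshev.node n k := funext hsdef
  obtain ⟨c, hc, hw⟩ := Chebyshev.exists_mul_nodalWeight_node (show n ≠ 0 by omega)
  have hinj : Set.InjOn s (univ : Finset (Fin (n + 1))) :=
    (hs ▸ Chebyshev.injective_node_fin n).injOn
  have hdeg' : p.degree < #(univ : Finset (Fin (n + 1))) := by
    rw [card_univ, Fintype.card_fin]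
    exact hdeg.trans_lt (by exact_mod_cast Nat.lt_succ_self n)
  rw [← hs] at hw
  rw [Lagrange.eq_interpolate_of_eval_eq f hinj hdeg' fun k _ ↦ hinterp k,
    Lagrange.eval_interpolate_not_at_node' f hinj univ_nonempty fun k _ ↦ ht k]
  simp only [hw]
  rw [← mul_div_mul_left _ _ hc, mul_sum, mul_sum]
  simp only [div_eq_mul_inv, mul_assoc]
end

section
/- Let f : ℝ → ℝ be Lipschitz continuous on [−1,1]. For each n ≥ 1 let p_n be the unique polynomial of degree at most n interpolating f at the Chebyshev points of the second kind s_k = cos(kπ/n), k = 0, …, n. Then p_n converges uniformly to f on [−1,1] as n → ∞, i.e., sup_{t ∈ [−1,1]} |f(t) − p_n(t)| → 0. -/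
open Finset Real Polynomial Filter

/-- A polynomial of degree at most `n` becomes a cosine polynomial of degree at most `n` under
`t = cos θ`. -/
theorem Polynomial.exists_eval_cos_eq_sum_cos {n : ℕ} {P : ℝ[X]} (hP : P.degree ≤ n) :
    ∃ a : ℕ → ℝ, ∀ θ : ℝ, P.eval (cos θ) = ∑ m ∈ range (n + 1), a m * cos (m * θ) := by
  induction n generalizing P with
  | zero =>
    refine ⟨fun _ => P.coeff 0, fun θ => ?_⟩
    have hP : P.degree ≤ 0 := by simpa using hP
    conv_lhs => rw [eq_C_of_degree_le_zero hP]
    simp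
  | succ n ih =>
    set T := Chebyshev.T ℝ ((n + 1 : ℕ) : ℤ) with hT
    have hdT : T.degree = (n + 1 : ℕ) := by simp only [hT, Chebyshev.degree_T, Int.natAbs_natCast]
    have hT0 : T.coeff (n + 1) ≠ 0 := coeff_ne_zero_of_eq_degree hdT
    set c := P.coeff (n + 1) / T.coeff (n + 1)
    obtain ⟨a, ha⟩ := ih (P := P - C c * T) <| by
      rw [degree_le_iff_coeff_zero]
      intro m hm
      have hm : n + 1 ≤ m := by exact_mod_cast hm
      rcases hm.eq_or_lt with rfl | hm
      · simp [c, hT0]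
      · have h : ((n + 1 : ℕ) : WithBot ℕ) < m := by exact_mod_cast hm
        rw [coeff_sub, coeff_C_mul, coeff_eq_zero_of_degree_lt (hP.trans_lt h),
          coeff_eq_zero_of_degree_lt (hdT.trans_lt h)]
        simp
    refine ⟨Function.update a (n + 1) c, fun θ => ?_⟩
    have hθ := ha θ
    rw [eval_sub, eval_mul, eval_C, hT, Chebyshev.T_real_cos] at hθ
    rw [sum_range_succ, sum_congr rfl fun m hm => by
      rw [Function.update_of_ne (mem_range.1 hm).ne], ← hθ]
    simp

theorem Real.sum_cos_odd_mul_pi_div_eq_zero {n : ℕ} (hn : n ≠ 0) {k : ℤ} (hk : ¬ (2 * n : ℤ) ∣ k) :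
    ∑ i ∈ range n, cos (k * ((2 * i + 1) / (2 * n) * π)) = 0 := by
  have h := Chebyshev.sumZeroes_T_of_not_dvd hk
  rw [Chebyshev.sumZeroes, mul_eq_zero_iff_left (by positivity)] at h
  simpa only [Chebyshev.T_real_cos] using h

/-- Discrete orthogonality of the sines at the midpoints `(2 * i + 1) * π / (2 * n)`, `i < n`. -/
theorem Real.sum_sin_mul_sin_eq_zero {n : ℕ} {l m : ℕ} (hl : l < n) (hm : m < n) (hlm : l ≠ m) :
    ∑ i ∈ range n, sin ((l + 1 : ℕ) * ((2 * i + 1) / (2 * n) * π)) *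
      sin ((m + 1 : ℕ) * ((2 * i + 1) / (2 * n) * π)) = 0 := by
  have hn : n ≠ 0 := by omega
  have hs : ¬ (2 * n : ℤ) ∣ (l - m : ℤ) := fun h => by
    have := Int.eq_zero_of_abs_lt_dvd h (by rw [abs_lt]; omega)
    omega
  have ha : ¬ (2 * n : ℤ) ∣ (l + m + 2 : ℤ) := fun h => by
    have := Int.le_of_dvd (by omega) h
    omega
  have h1 := sum_cos_odd_mul_pi_div_eq_zero hn hs
  have h2 := sum_cos_odd_mul_pi_div_eq_zero hn ha
  rw [← mul_right_inj' two_ne_zero, mul_sum, mul_zero, ← sub_zero (0 : ℝ)]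
  nth_rw 1 [← h1]
  rw [← h2, ← sum_sub_distrib]
  refine sum_congr rfl fun i _ => ?_
  rw [← mul_assoc, two_mul_sin_mul_sin]
  push_cast
  ring_nf

theorem Real.half_le_sum_sin_sq {n m : ℕ} (hm : m < n) :
    (n : ℝ) / 2 ≤ ∑ i ∈ range n, sin ((m + 1 : ℕ) * ((2 * i + 1) / (2 * n) * π)) ^ 2 := by
  have hn : n ≠ 0 := by omega
  have hn' : (n : ℝ) ≠ 0 := by exact_mod_cast hn
  rcases Nat.succ_le_of_lt hm |>.eq_or_lt with h | h
  · have : ∀ i ∈ range n, sin ((m + 1 : ℕ) * ((2 * i + 1) / (2 * n) * π)) ^ 2 = 1 := fun i _ => by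
      have : ((m + 1 : ℕ) * ((2 * i + 1) / (2 * n) * π) : ℝ) = i * π + π / 2 := by
        rw [show m + 1 = n from h]; field
      rw [this, sin_add_pi_div_two, cos_nat_mul_pi, pow_right_comm]
      simp
    rw [sum_congr rfl this]
    simp
  · have ha : ¬ (2 * n : ℤ) ∣ (2 * (m + 1) : ℤ) := fun h => by
      have := Int.le_of_dvd (by omega) h
      omega
    have h2 := sum_cos_odd_mul_pi_div_eq_zero hn ha
    have : ∀ i ∈ range n, sin ((m + 1 : ℕ) * ((2 * i + 1) / (2 * n) * π)) ^ 2 =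
        2⁻¹ - cos ((2 * (m + 1) : ℤ) * ((2 * i + 1) / (2 * n) * π)) / 2 := fun i _ => by
      rw [sin_sq_eq_half_sub, one_div]
      push_cast
      ring_nf
    rw [sum_congr rfl this, sum_sub_distrib, ← sum_div, h2]
    simp [div_eq_mul_inv]

/-- A Bessel inequality for the discrete sine system at the midpoints `(2 * i + 1) * π / (2 * n)`,
`i < n`. -/
theorem Real.sum_sq_le_sum_sq_sum_sin (n : ℕ) (b : ℕ → ℝ) :
    (n : ℝ) / 2 * ∑ m ∈ range n, b m ^ 2 ≤ ∑ i ∈ range n,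
      (∑ m ∈ range n, b m * sin ((m + 1 : ℕ) * ((2 * i + 1) / (2 * n) * π))) ^ 2 := by
  simp_rw [sq (∑ m ∈ range n, _), sum_mul_sum]
  rw [sum_comm, mul_sum]
  refine sum_le_sum fun l hl => ?_
  rw [sum_comm, sum_eq_single_of_mem l hl]
  · calc (n : ℝ) / 2 * b l ^ 2 ≤
        (∑ i ∈ range n, sin ((l + 1 : ℕ) * ((2 * i + 1) / (2 * n) * π)) ^ 2) * b l ^ 2 := by
          gcongr; exact half_le_sum_sin_sq (mem_range.1 hl)
      _ = _ := by rw [sum_mul]; exact sum_congr rfl fun i _ => by ring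
  · intro m hm hml
    rw [← mul_zero (b l * b m), ← sum_sin_mul_sin_eq_zero (mem_range.1 hl) (mem_range.1 hm) hml.symm,
      mul_sum]
    exact sum_congr rfl fun i _ => by ring

/-- The `L²` norm of the derivative of a cosine polynomial is controlled by the increments over the
grid `i * π / n`. -/
theorem Real.sum_sq_mul_sq_le_sum_sq_sub {n : ℕ} (hn : n ≠ 0) (a : ℕ → ℝ) {q : ℝ → ℝ}
    (hq : ∀ θ, q θ = ∑ m ∈ range (n + 1), a m * cos (m * θ)) :
    ∑ m ∈ range n, (a (m + 1) * (m + 1 : ℕ)) ^ 2 ≤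
      n / 2 * ∑ i ∈ range n, (q ((i + 1 : ℕ) * π / n) - q (i * π / n)) ^ 2 := by
  have hn' : (0 : ℝ) < n := by positivity
  have hdiff : ∀ i : ℕ, q ((i + 1 : ℕ) * π / n) - q (i * π / n) =
      ∑ m ∈ range n, (-2 * a (m + 1) * sin ((m + 1 : ℕ) * π / (2 * n))) *
        sin ((m + 1 : ℕ) * ((2 * i + 1) / (2 * n) * π)) := fun i => by
    rw [hq, hq, ← sum_sub_distrib, sum_range_succ']
    simp only [Nat.cast_zero, zero_mul, sub_self, add_zero]
    refine sum_congr rfl fun m _ => ?_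
    rw [← mul_sub, cos_sub_cos,
      show ((m + 1 : ℕ) * ((i + 1 : ℕ) * π / n) + (m + 1 : ℕ) * (i * π / n)) / 2
        = (m + 1 : ℕ) * ((2 * i + 1) / (2 * n) * π) by push_cast; field,
      show ((m + 1 : ℕ) * ((i + 1 : ℕ) * π / n) - (m + 1 : ℕ) * (i * π / n)) / 2
        = (m + 1 : ℕ) * π / (2 * n) by push_cast; field]
    ring
  have hsin : ∀ m ∈ range n, (2 / n * (a (m + 1) * (m + 1 : ℕ))) ^ 2 ≤
      (-2 * a (m + 1) * sin ((m + 1 : ℕ) * π / (2 * n))) ^ 2 := fun m hm => by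
    have hm : ((m + 1 : ℕ) : ℝ) ≤ n := by exact_mod_cast mem_range.1 hm
    have h := mul_le_sin (x := (m + 1 : ℕ) * π / (2 * n)) (by positivity) (by
      rw [div_le_div_iff₀ (by positivity) (by positivity)]; nlinarith [pi_pos])
    rw [show 2 / π * ((m + 1 : ℕ) * π / (2 * n)) = (m + 1 : ℕ) / (n : ℝ) by field] at h
    calc (2 / n * (a (m + 1) * (m + 1 : ℕ))) ^ 2
        = 4 * a (m + 1) ^ 2 * ((m + 1 : ℕ) / (n : ℝ)) ^ 2 := by ring
      _ ≤ 4 * a (m + 1) ^ 2 * sin ((m + 1 : ℕ) * π / (2 * n)) ^ 2 := by gcongr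
      _ = _ := by ring
  have key := (mul_le_mul_of_nonneg_left (sum_le_sum hsin) (by positivity)).trans
    (sum_sq_le_sum_sq_sum_sin n _)
  simp_rw [← hdiff, mul_pow (2 / (n : ℝ)), ← mul_sum] at key
  calc _ = n / 2 * (n / 2 * ((2 / n) ^ 2 * ∑ m ∈ range n, (a (m + 1) * (m + 1 : ℕ)) ^ 2)) := by
        field
    _ ≤ _ := by
      simp_rw [mul_pow (a _)] at key ⊢
      gcongr

/-- A cosine polynomial is controlled at each pair of points by the `L²` norm of its derivative. -/
theorem Real.sq_sum_cos_sub_le (n : ℕ) (a : ℕ → ℝ) {q : ℝ → ℝ}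
    (hq : ∀ θ, q θ = ∑ m ∈ range (n + 1), a m * cos (m * θ)) (x y : ℝ) :
    (q x - q y) ^ 2 ≤ (∑ m ∈ range n, (a (m + 1) * (m + 1 : ℕ)) ^ 2) * (n * (x - y) ^ 2) := by
  have h : q x - q y = ∑ m ∈ range n, (a (m + 1) * (m + 1 : ℕ)) *
      ((cos ((m + 1 : ℕ) * x) - cos ((m + 1 : ℕ) * y)) / (m + 1 : ℕ)) := by
    rw [hq, hq, ← sum_sub_distrib, sum_range_succ']
    simp only [Nat.cast_zero, zero_mul, sub_self, add_zero]
    refine sum_congr rfl fun m _ => ?_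
    field
  rw [h]
  refine (sum_mul_sq_le_sq_mul_sq _ _ _).trans ?_
  gcongr
  calc _ ≤ ∑ m ∈ range n, (x - y) ^ 2 := sum_le_sum fun m _ => by
        rw [sq_le_sq, abs_div, Nat.abs_cast, div_le_iff₀ (by positivity)]
        refine (abs_cos_sub_cos_le _ _).trans_eq ?_
        rw [← mul_sub, abs_mul, Nat.abs_cast, mul_comm]
    _ = _ := by simp

/-- Quantitative error bound for interpolation of a Lipschitz function at the Chebyshev points of the
second kind. -/
theorem abs_eval_sub_le_of_interpolates {f : ℝ → ℝ} {K : NNReal}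
    (hf : LipschitzOnWith K f (Set.Icc (-1 : ℝ) 1)) {n : ℕ} (hn : n ≠ 0) {P : ℝ[X]}
    (hdeg : P.degree ≤ n)
    (hP : ∀ k ≤ n, P.eval (cos (k * π / n)) = f (cos (k * π / n)))
    {t : ℝ} (ht : t ∈ Set.Icc (-1 : ℝ) 1) :
    |P.eval t - f t| ≤ K * π ^ 2 / √n + K * π / n := by
  have hn' : (0 : ℝ) < n := by positivity
  have hfcos (x y : ℝ) : |f (cos x) - f (cos y)| ≤ K * |x - y| :=
    (hf.dist_le_mul _ (cos_mem_Icc x) _ (cos_mem_Icc y)).trans <| by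
      gcongr; exact abs_cos_sub_cos_le x y
  obtain ⟨a, ha⟩ := P.exists_eval_cos_eq_sum_cos hdeg
  have hcoeff : ∑ m ∈ range n, (a (m + 1) * (m + 1 : ℕ)) ^ 2 ≤ (K * π) ^ 2 := by
    refine (sum_sq_mul_sq_le_sum_sq_sub hn a (q := fun θ => P.eval (cos θ)) ha).trans ?_
    calc _ ≤ n / 2 * ∑ i ∈ range n, (K * (π / n)) ^ 2 := by
          refine mul_le_mul_of_nonneg_left (sum_le_sum fun i hi => ?_) (by positivity)
          have hi := mem_range.1 hi
          rw [hP _ hi, hP _ hi.le]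
          refine sq_le_sq.2 ((hfcos _ _).trans_eq ?_)
          rw [abs_mul, NNReal.abs_eq, ← sub_div, ← sub_mul]
          simp
      _ = (K * π) ^ 2 / 2 := by rw [sum_const, card_range, nsmul_eq_mul]; field
      _ ≤ _ := half_le_self (by positivity)
  obtain ⟨θ, hθ, rfl⟩ : ∃ θ ∈ Set.Icc 0 π, cos θ = t :=
    ⟨arccos t, ⟨arccos_nonneg t, arccos_le_pi t⟩, cos_arccos ht.1 ht.2⟩
  obtain ⟨k, hk, hθk⟩ : ∃ k ≤ n, |θ - k * π / n| ≤ π / n := by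
    have h0 : 0 ≤ n * θ / π := div_nonneg (mul_nonneg hn'.le hθ.1) pi_pos.le
    refine ⟨⌊n * θ / π⌋₊, Nat.floor_le_of_le ?_, ?_⟩
    · rw [div_le_iff₀ pi_pos]; gcongr; exact hθ.2
    · have h1 := Nat.floor_le h0
      have h2 := Nat.lt_floor_add_one (n * θ / π)
      rw [show θ - ⌊n * θ / π⌋₊ * π / n = (n * θ / π - ⌊n * θ / π⌋₊) * (π / n) by field, abs_mul,
        abs_of_nonneg (sub_nonneg.2 h1), abs_of_pos (by positivity)]
      exact mul_le_of_le_one_left (by positivity) (by linarith)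
  have hPθ : |P.eval (cos θ) - P.eval (cos (k * π / n))| ≤ K * π ^ 2 / √n := by
    refine abs_le_of_sq_le_sq ?_ (by positivity)
    refine (sq_sum_cos_sub_le n a (q := fun θ => P.eval (cos θ)) ha _ _).trans ?_
    calc _ ≤ (K * π) ^ 2 * (n * (π / n) ^ 2) := by
          gcongr ?_ * (_ * ?_)
          exact sq_le_sq' (by linarith [abs_le.1 hθk]) (abs_le.1 hθk).2
      _ = _ := by rw [div_pow _ √_, sq_sqrt hn'.le]; field
  calc _ ≤ |P.eval (cos θ) - P.eval (cos (k * π / n))| +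
        |f (cos (k * π / n)) - f (cos θ)| := by
          rw [← hP k hk]; exact abs_sub_le _ _ _
    _ ≤ _ := by
      refine add_le_add hPθ ?_
      rw [abs_sub_comm, mul_div_assoc (K : ℝ)]
      refine (hfcos _ _).trans ?_
      gcongr

/-- **Uniform convergence of Chebyshev interpolants for Lipschitz functions.**
Let `f : ℝ → ℝ` be Lipschitz continuous on `[-1,1]`.  For each `n ≥ 1` let `p n` be the
(unique) polynomial of degree at most `n` interpolating `f` at the Chebyshev points of
the second kind `cos (k π / n)`, `k = 0, …, n`.  Then `p n` converges uniformly to `f`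
on `[-1,1]` as `n → ∞`. -/
theorem chebyshev_interpolants_tendstoUniformly
    (f : ℝ → ℝ) (K : NNReal) (hf : LipschitzOnWith K f (Set.Icc (-1 : ℝ) 1))
    (p : ℕ → Polynomial ℝ)
    (hdeg : ∀ n : ℕ, 1 ≤ n → (p n).degree ≤ n)
    (hinterp : ∀ n : ℕ, 1 ≤ n → ∀ k : Fin (n + 1),
      (p n).eval (Real.cos (k * π / n)) = f (Real.cos (k * π / n))) :
    TendstoUniformlyOn (fun n t => (p n).eval t) f Filter.atTop (Set.Icc (-1 : ℝ) 1) := by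
  have hlim : Tendsto (fun n : ℕ => K * π ^ 2 / √n + K * π / n) atTop (nhds (0 : ℝ)) := by
    simpa using (tendsto_const_nhds.div_atTop
      (tendsto_sqrt_atTop.comp tendsto_natCast_atTop_atTop)).add
      (tendsto_const_nhds.div_atTop tendsto_natCast_atTop_atTop)
  rw [Metric.tendstoUniformlyOn_iff]
  intro ε hε
  filter_upwards [hlim.eventually_lt_const hε, eventually_ge_atTop 1] with n hnε hn t ht
  rw [dist_comm, Real.dist_eq]
  exact (abs_eval_sub_le_of_interpolates hf (by omega) (hdeg n hn)
    (fun k hk => hinterp n hn ⟨k, by omega⟩) ht).trans_lt hnε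
end
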